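/- Suppose H is basic. Let x ∈ ℤ be a periodic point of H whose cycle contains at least two elements, i.e., H^{∘L}(x) = x for some L ≥ 2 and H(x) ≠ x. Then there exist an element y of the cycle {x, H(x), …, H^{∘(L−1)}(x)} and an integer n ≥ 1 such that M_H(n) ≠ 1 and (y : ℚ) = χ_H(n)/(1 − M_H(n)). -/

import Mathlib

/-- `qH ϱ a` is the greatest common divisor of the set `{a_j : j < ϱ, a_j ≠ 1}`. -/
def qH (ϱ : ℕ) (a : ℕ → ℤ) : ℤ :=
  Finset.gcd ((Finset.range ϱ).filter fun j => a j ≠ 1) a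

/-- `Mstr a d l = ∏_{k=1}^{L} a_{j_k}/d_{j_k}` for the string `l = (j_1, …, j_L)`. -/
def Mstr (a d : ℕ → ℤ) (l : List ℕ) : ℚ :=
  (l.map fun j => (a j : ℚ) / (d j : ℚ)).prod

/-- `chiStr a b d l = Σ_{m=1}^{L} (b_{j_m}/d_{j_m}) ∏_{k=1}^{m−1} a_{j_k}/d_{j_k}`. -/
def chiStr (a b d : ℕ → ℤ) (l : List ℕ) : ℚ :=
  ∑ m ∈ Finset.range l.length,
    ((l.map fun j => (b j : ℚ) / (d j : ℚ)).getD m 0) * Mstr a d (l.take m)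

/-- `MH a d ϱ n = M_H(n)` via the base-`ϱ` digit string of `n`. -/
def MH (a d : ℕ → ℤ) (ϱ n : ℕ) : ℚ := Mstr a d (Nat.digits ϱ n)

/-- `chiH a b d ϱ n = χ_H(n)` via the base-`ϱ` digit string of `n`. -/
def chiH (a b d : ℕ → ℤ) (ϱ n : ℕ) : ℚ := chiStr a b d (Nat.digits ϱ n)

theorem Mstr_cons (a d : ℕ → ℤ) (j : ℕ) (l : List ℕ) :
    Mstr a d (j :: l) = (a j : ℚ) / d j * Mstr a d l := by
  simp [Mstr]

theorem chiStr_cons (a b d : ℕ → ℤ) (j : ℕ) (l : List ℕ) :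
    chiStr a b d (j :: l) = (b j : ℚ) / d j + (a j : ℚ) / d j * chiStr a b d l := by
  unfold chiStr
  rw [List.length_cons, Finset.sum_range_succ', Finset.mul_sum, add_comm]
  congr 1
  · simp [Mstr]
  · refine Finset.sum_congr rfl fun m _ => ?_
    rw [List.take_succ_cons, Mstr_cons, List.map_cons, List.getD_cons_succ]
    ring

theorem Mstr_mul_pow (a : ℕ → ℤ) {ϱ : ℕ} (hϱ : ϱ ≠ 0) (l : List ℕ) :
    Mstr a (fun _ => (ϱ : ℤ)) l * (ϱ : ℚ) ^ l.length = ((l.map a).prod : ℤ) := by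
  have hϱ' : (ϱ : ℚ) ≠ 0 := Nat.cast_ne_zero.mpr hϱ
  induction l with
  | nil => simp [Mstr]
  | cons j l ih =>
    rw [Mstr_cons, List.length_cons, List.map_cons, List.prod_cons, Int.cast_mul, ← ih, pow_succ]
    push_cast
    field_simp

/-- If every multiplier is coprime to `ϱ ≥ 2`, only the empty string has `Mstr = 1`. -/
theorem Mstr_ne_one {a : ℕ → ℤ} {ϱ : ℕ} (hϱ : 2 ≤ ϱ)
    (hcop : ∀ j < ϱ, Int.gcd (a j) (ϱ : ℤ) = 1) {l : List ℕ} (hl : ∀ j ∈ l, j < ϱ)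
    (hne : l ≠ []) : Mstr a (fun _ => (ϱ : ℤ)) l ≠ 1 := by
  intro h
  have hprod := Mstr_mul_pow a (by lia : ϱ ≠ 0) l
  rw [h, one_mul] at hprod
  have hZ : (ϱ : ℤ) ^ l.length = (l.map a).prod := by exact_mod_cast hprod
  have hc : IsCoprime (l.map a).prod (ϱ : ℤ) := by
    clear h hprod hZ hne
    induction l with
    | nil => simpa using isCoprime_one_left
    | cons j l ih =>
      rw [List.map_cons, List.prod_cons]
      exact (Int.isCoprime_iff_gcd_eq_one.mpr (hcop j (hl j (by simp)))).mul_left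
        (ih fun i hi => hl i (by simp [hi]))
  rw [← hZ] at hc
  have hu := (IsCoprime.pow_left_iff (List.length_pos_iff.mpr hne)).mp hc
  rw [isCoprime_self, Int.isUnit_iff] at hu
  lia

/-- The residues mod `ϱ` of `y, H y, …, H^[n-1] y`, most recent first. -/
def residueString (ϱ : ℕ) (H : ℤ → ℤ) (y : ℤ) : ℕ → List ℕ
  | 0 => []
  | n + 1 => (H^[n] y % (ϱ : ℤ)).toNat :: residueString ϱ H y n

theorem lt_of_mem_residueString {ϱ : ℕ} (hϱ : 0 < ϱ) (H : ℤ → ℤ) (y : ℤ) {n j : ℕ}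
    (hj : j ∈ residueString ϱ H y n) : j < ϱ := by
  induction n with
  | zero => simp [residueString] at hj
  | succ n ih =>
    rcases List.mem_cons.mp hj with rfl | hj
    · have := Int.emod_lt_of_pos (H^[n] y) (by exact_mod_cast hϱ : (0 : ℤ) < ϱ)
      lia
    · exact ih hj

theorem getLast?_residueString_succ (ϱ : ℕ) (H : ℤ → ℤ) (y : ℤ) (n : ℕ) :
    (residueString ϱ H y (n + 1)).getLast? = some (y % (ϱ : ℤ)).toNat := by
  induction n with
  | zero => simp [residueString]
  | succ n ih => rw [residueString, List.getLast?_cons, ih, Option.getD_some]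

theorem iterate_eq_Mstr_mul_add_chiStr {ϱ : ℕ} (hϱ : ϱ ≠ 0) {a b : ℕ → ℤ} {H : ℤ → ℤ}
    (hH : ∀ n : ℤ, (ϱ : ℤ) * H n = a (n % (ϱ : ℤ)).toNat * n + b (n % (ϱ : ℤ)).toNat)
    (y : ℤ) (n : ℕ) :
    ((H^[n] y : ℤ) : ℚ) = Mstr a (fun _ => (ϱ : ℤ)) (residueString ϱ H y n) * y
      + chiStr a b (fun _ => (ϱ : ℤ)) (residueString ϱ H y n) := by
  have hϱ' : (ϱ : ℚ) ≠ 0 := Nat.cast_ne_zero.mpr hϱ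
  induction n with
  | zero => simp [residueString, Mstr, chiStr]
  | succ n ih =>
    have h : (ϱ : ℚ) * (H (H^[n] y) : ℤ) = a (H^[n] y % (ϱ : ℤ)).toNat * (H^[n] y : ℤ)
        + b (H^[n] y % (ϱ : ℤ)).toNat := by exact_mod_cast hH (H^[n] y)
    rw [Function.iterate_succ_apply', residueString, Mstr_cons, chiStr_cons,
      ← mul_right_inj' hϱ', h, ih]
    push_cast
    field_simp
    ring

/-- A cycle lying in the residue class of `0` consists of the fixed point `0`. -/
theorem eq_zero_of_forall_iterate_emod_eq_zero {ϱ : ℕ} (hϱ : 2 ≤ ϱ) {a b : ℕ → ℤ}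
    (hb0 : b 0 = 0) (hcop : ∀ j < ϱ, Int.gcd (a j) (ϱ : ℤ) = 1) {H : ℤ → ℤ}
    (hH : ∀ n : ℤ, (ϱ : ℤ) * H n = a (n % (ϱ : ℤ)).toNat * n + b (n % (ϱ : ℤ)).toNat)
    {x : ℤ} {L : ℕ} (hL : L ≠ 0) (hper : H^[L] x = x)
    (hdvd : ∀ k < L, H^[k] x % (ϱ : ℤ) = 0) : x = 0 := by
  have hpow : ∀ n ≤ L, (ϱ : ℤ) ^ n * H^[n] x = a 0 ^ n * x := by
    intro n hn
    induction n with
    | zero => simp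
    | succ n ih =>
      have h := hH (H^[n] x)
      rw [hdvd n hn, Int.toNat_zero, hb0, add_zero] at h
      rw [Function.iterate_succ_apply', pow_succ, mul_assoc, h, pow_succ]
      linear_combination a 0 * ih (by lia)
  have hLx := hpow L le_rfl
  rw [hper] at hLx
  by_contra hx
  have heq := mul_right_cancel₀ hx hLx
  have hc : IsCoprime (a 0 ^ L) (ϱ : ℤ) :=
    (Int.isCoprime_iff_gcd_eq_one.mpr (hcop 0 (by lia))).pow_left
  rw [← heq, IsCoprime.pow_left_iff (Nat.pos_of_ne_zero hL), isCoprime_self, Int.isUnit_iff] at hc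
  lia

/-- suppose `H` is basic. If `x ∈ ℤ` is a periodic point of `H`
whose cycle has at least two elements (`H^[L] x = x`, `L ≥ 2`, `H x ≠ x`), then
there exist an element `y = H^[k] x` (`k < L`) of the cycle and an integer
`n ≥ 1` with `M_H(n) ≠ 1` and `y = χ_H(n)/(1 − M_H(n))`. -/
theorem stmt13 (ϱ : ℕ) (hϱ : 2 ≤ ϱ) (a b : ℕ → ℤ)
    (ha : ∀ j < ϱ, 0 < a j) (hb0 : b 0 = 0)
    (hcop : ∀ j < ϱ, Int.gcd (a j) (ϱ : ℤ) = 1)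
    (hnd : ∀ j, 0 < j → j < ϱ → a j ≠ 1)
    (hq : (2 : ℤ) ≤ qH ϱ a)
    (hint : ∀ j < ϱ, ∀ ℓ : ℤ, (ϱ : ℤ) ∣ (a j * ℓ + b j) ↔ ℓ % (ϱ : ℤ) = (j : ℤ))
    (H : ℤ → ℤ)
    (hH : ∀ n : ℤ, (ϱ : ℤ) * H n
        = a (n % (ϱ : ℤ)).toNat * n + b (n % (ϱ : ℤ)).toNat)
    (x : ℤ) (L : ℕ) (hL : 2 ≤ L) (hper : H^[L] x = x) (hfix : H x ≠ x) :
    ∃ k < L, ∃ n : ℕ, 1 ≤ n ∧ MH a (fun _ => (ϱ : ℤ)) ϱ n ≠ 1 ∧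
      ((H^[k] x : ℤ) : ℚ)
        = chiH a b (fun _ => (ϱ : ℤ)) ϱ n / (1 - MH a (fun _ => (ϱ : ℤ)) ϱ n) := by
  have hϱ0 : ϱ ≠ 0 := by lia
  have hk : ∃ k < L, H^[k] x % (ϱ : ℤ) ≠ 0 := by
    by_contra! hdvd
    have hx := eq_zero_of_forall_iterate_emod_eq_zero hϱ hb0 hcop hH (by lia) hper hdvd
    have h := hH 0
    rw [Int.zero_emod, Int.toNat_zero, hb0, mul_zero, add_zero] at h
    rcases mul_eq_zero.mp h with h | h
    · exact hϱ0 (by exact_mod_cast h)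
    · exact hfix (by rw [hx, h])
  obtain ⟨k, hkL, hk⟩ := hk
  have hyper : H^[L] (H^[k] x) = H^[k] x := by
    rw [← Function.iterate_add_apply, add_comm, Function.iterate_add_apply, hper]
  generalize hy : H^[k] x = y at hk hyper
  obtain ⟨M, rfl⟩ := Nat.exists_eq_succ_of_ne_zero (by lia : L ≠ 0)
  set l := residueString ϱ H y (M + 1) with hl
  have hlt : ∀ j ∈ l, j < ϱ := fun j hj => lt_of_mem_residueString (by lia) H y hj
  have hne : l ≠ [] := by simp [hl, residueString]
  have hlast : ∀ h : l ≠ [], l.getLast h ≠ 0 := by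
    intro h
    have hg := getLast?_residueString_succ ϱ H y M
    rw [← hl, List.getLast?_eq_getLast_of_ne_nil h, Option.some_inj] at hg
    have := Int.emod_nonneg y (by exact_mod_cast hϱ0 : (ϱ : ℤ) ≠ 0)
    lia
  have hdig : Nat.digits ϱ (Nat.ofDigits ϱ l) = l :=
    Nat.digits_ofDigits ϱ (by lia) l hlt hlast
  have hM := Mstr_ne_one hϱ hcop hlt hne
  refine ⟨k, hkL, Nat.ofDigits ϱ l, ?_, ?_, ?_⟩
  · rw [Nat.one_le_iff_ne_zero]
    intro h
    rw [h, Nat.digits_zero] at hdig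
    exact hne hdig.symm
  · rwa [MH, hdig]
  · have h := iterate_eq_Mstr_mul_add_chiStr hϱ0 hH y (M + 1)
    rw [hyper, ← hl] at h
    rw [hy, MH, chiH, hdig, eq_div_iff (sub_ne_zero.mpr hM.symm)]
    linear_combination h
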